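/- Let k ≥ 1 be an integer and let α be a real number with 1 − 2^{−k} ≤ α ≤ 1 − 2^{−(k+1)}. Define f(α) := limsup_{n→∞} log(e_{⌊n^α⌋}(n))/log(n). Then f(α) ≥ max{(1 − α)·2^k, α/(1 − 2^{−(k+1)})}. -/

import Mathlib

open Filter

/-- A finite subset `S` of the `n`-dimensional hypercube (binary sequences of
length `n`) is `d`-equilateral if it is nonempty and any two distinct points
have Hamming distance exactly `d`. -/
def IsEquilateralSet {n : ℕ} (d : ℕ) (S : Finset (Fin n → Bool)) : Prop :=
  S.Nonempty ∧ ∀ x ∈ S, ∀ y ∈ S, x ≠ y → hammingDist x y = d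

/-- `equilateralDim d n` is the maximal size of a `d`-equilateral subset of the
`n`-dimensional hypercube. -/
noncomputable def equilateralDim (d n : ℕ) : ℕ :=
  sSup {m : ℕ | ∃ S : Finset (Fin n → Bool), IsEquilateralSet d S ∧ S.card = m}

/-- There are `m` words of length `n` at pairwise Hamming distance `d`. -/
def HasEquidistantFamily (d n m : ℕ) : Prop :=
  ∃ c : Fin m → Fin n → Bool, ∀ i j, i ≠ j → hammingDist (c i) (c j) = d

lemma hammingDist_eq_sum {ι : Type*} [Fintype ι] (x y : ι → Bool) :
    hammingDist x y = ∑ i, (x i ^^ y i).toNat := by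
  rw [hammingDist, Finset.card_filter]
  refine Finset.sum_congr rfl fun i _ => ?_
  cases x i <;> cases y i <;> rfl

lemma HasEquidistantFamily.of_fintype {ι κ : Type*} [Fintype ι] [Fintype κ] {d n m : ℕ}
    (c : ι → κ → Bool) (hι : Fintype.card ι = m) (hκ : Fintype.card κ = n)
    (h : ∀ i j, i ≠ j → hammingDist (c i) (c j) = d) : HasEquidistantFamily d n m := by
  let e := Fintype.equivFinOfCardEq hι
  let e' := Fintype.equivFinOfCardEq hκ
  refine ⟨fun i k => c (e.symm i) (e'.symm k), fun i j hij => ?_⟩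
  rw [← h (e.symm i) (e.symm j) (by simpa using hij), hammingDist_eq_sum, hammingDist_eq_sum]
  exact Equiv.sum_comp e'.symm
    (fun k => (c (e.symm i) k ^^ c (e.symm j) k).toNat)

lemma hasEquidistantFamily_unit_vectors (m : ℕ) : HasEquidistantFamily 2 m m := by
  refine ⟨fun i k => decide (k = i), fun i j hij => ?_⟩
  have : (Finset.univ.filter fun k => decide (k = i) ≠ decide (k = j)) = {i, j} := by
    ext k
    simp only [Finset.mem_filter, Finset.mem_univ, true_and, Finset.mem_insert,
      Finset.mem_singleton, ne_eq, decide_eq_decide]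
    grind
  rw [hammingDist, this, Finset.card_pair hij]

lemma HasEquidistantFamily.replicate {d n m : ℕ} (h : HasEquidistantFamily d n m) (t : ℕ) :
    HasEquidistantFamily (t * d) (t * n) m := by
  obtain ⟨c, hc⟩ := h
  refine .of_fintype (ι := Fin m) (κ := Fin t × Fin n) (fun i k => c i k.2) (by simp) (by simp)
    fun i j hij => ?_
  rw [hammingDist_eq_sum, Fintype.sum_prod_type, Finset.sum_congr rfl
    fun x _ => (hammingDist_eq_sum (c i) (c j)).symm.trans (hc i j hij)]
  simp

lemma HasEquidistantFamily.mono_length {d n m N : ℕ} (h : HasEquidistantFamily d n m)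
    (hN : n ≤ N) : HasEquidistantFamily d N m := by
  obtain ⟨c, hc⟩ := h
  refine .of_fintype (ι := Fin m) (κ := Fin n ⊕ Fin (N - n))
    (fun i => Sum.elim (c i) fun _ => false) (by simp) (by simp; omega) fun i j hij => ?_
  rw [hammingDist_eq_sum, Fintype.sum_sum_type, ← hc i j hij,
    hammingDist_eq_sum (c i)]
  simp

/-- Two distinct words of the two-dimensional simplex code over a field with `q` elements differ
in exactly `q` places. -/
lemma sum_option_affine {F : Type*} [Field F] [Fintype F] [DecidableEq F] {u v : F × F}
    (huv : u ≠ v) (d : ℕ) :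
    ∑ x : Option F, (if x.elim u.1 (fun x => u.1 * x + u.2) =
      x.elim v.1 (fun x => v.1 * x + v.2) then 0 else d) = Fintype.card F * d := by
  obtain ⟨a, b⟩ := u
  obtain ⟨a', b'⟩ := v
  rw [Fintype.sum_option]
  by_cases ha : a = a'
  · subst ha
    have hb : b ≠ b' := fun h => huv (by rw [h])
    simp [hb]
  · have key : ∀ x : F, a * x + b = a' * x + b' ↔ x = (b' - b) / (a - a') := by
      intro x
      rw [eq_div_iff (sub_ne_zero.2 ha)]
      constructor <;> intro h <;> linear_combination h
    simp only [Option.elim_none, Option.elim_some, ha, if_false, key]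
    have h1 : ∑ x : F, (if x = (b' - b) / (a - a') then 0 else d) + d =
        ∑ x : F, ((if x = (b' - b) / (a - a') then 0 else d) +
          if x = (b' - b) / (a - a') then d else 0) := by
      rw [Finset.sum_add_distrib]; simp
    rw [add_comm, h1, Finset.sum_congr rfl (g := fun _ => d) (by intros; split_ifs <;> simp)]
    simp

/-- Concatenating an equidistant family with the two-dimensional simplex code over a field whose
size is the size of the family. -/
lemma HasEquidistantFamily.concat {p r d n : ℕ} [Fact p.Prime] (hr : r ≠ 0)
    (h : HasEquidistantFamily d n (p ^ r)) :
    HasEquidistantFamily (p ^ r * d) ((p ^ r + 1) * n) (p ^ r * p ^ r) := by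
  classical
  obtain ⟨c, hc⟩ := h
  let F := GaloisField p r
  have : Fintype F := Fintype.ofFinite F
  have hF : Fintype.card F = p ^ r := by rw [← Nat.card_eq_fintype_card, GaloisField.card p r hr]
  let e := Fintype.equivFinOfCardEq hF
  refine .of_fintype (ι := F × F) (κ := Option F × Fin n)
    (fun u k => c (e (k.1.elim u.1 (fun x => u.1 * x + u.2))) k.2)
    (by simp [hF]) (by simp [hF]) fun u v huv => ?_
  rw [hammingDist_eq_sum, Fintype.sum_prod_type]
  refine Eq.trans ?_ ((sum_option_affine huv d).trans (by rw [hF]))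
  refine Finset.sum_congr rfl fun x _ => ?_
  dsimp only
  rw [← hammingDist_eq_sum]
  split_ifs with hx
  · rw [hx, hammingDist_self]
  · exact hc _ _ (e.injective.ne hx)

lemma exists_hasEquidistantFamily {p : ℕ} (hp : p.Prime) (k : ℕ) :
    ∃ n ≤ 2 * p ^ 2 ^ k, HasEquidistantFamily (2 * p ^ (2 ^ k - 1)) n (p ^ 2 ^ k) := by
  have : Fact p.Prime := ⟨hp⟩
  suffices h : ∃ n, n * (p - 1) = p * (p ^ 2 ^ k - 1) ∧
      HasEquidistantFamily (2 * p ^ (2 ^ k - 1)) n (p ^ 2 ^ k) by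
    obtain ⟨n, hn, h⟩ := h
    refine ⟨n, ?_, h⟩
    obtain ⟨s, rfl⟩ : ∃ s, p = s + 2 := ⟨p - 2, by have := hp.two_le; omega⟩
    obtain ⟨Q, hQ⟩ : ∃ Q, (s + 2) ^ 2 ^ k = Q := ⟨_, rfl⟩
    rw [hQ] at hn ⊢
    have h1 : n * (s + 1) ≤ (s + 2) * Q := by
      rw [show s + 1 = s + 2 - 1 by omega, hn]
      exact Nat.mul_le_mul_left _ (Nat.sub_le _ _)
    by_contra! h2
    nlinarith
  induction k with
  | zero => exact ⟨p, by simp, by simpa using hasEquidistantFamily_unit_vectors p⟩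
  | succ k ih =>
    obtain ⟨n, hn, h⟩ := ih
    have hQ : 1 ≤ p ^ 2 ^ k := Nat.one_le_pow _ _ hp.pos
    have hk : 1 ≤ 2 ^ k := Nat.one_le_two_pow
    refine ⟨(p ^ 2 ^ k + 1) * n, ?_, ?_⟩
    · rw [mul_assoc, hn, pow_succ 2 k, pow_mul]
      obtain ⟨Q, hQ⟩ : ∃ Q, p ^ 2 ^ k = Q + 1 := ⟨_, (Nat.sub_add_cancel hQ).symm⟩
      rw [hQ, show (Q + 1) ^ 2 - 1 = Q * (Q + 2) by
        rw [show (Q + 1) ^ 2 = Q * (Q + 2) + 1 by ring]; rfl]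
      simp only [Nat.add_sub_cancel]
      ring
    · convert h.concat (by positivity) using 1
      · rw [mul_left_comm, ← pow_add]
        congr 2
        rw [pow_succ]; omega
      · rw [← pow_add, pow_succ, mul_two]

lemma IsEquilateralSet.card_le {n d : ℕ} (hd : d ≠ 0) {S : Finset (Fin n → Bool)}
    (hS : IsEquilateralSet d S) : S.card ≤ n + 1 := by
  let b : (Fin n → Bool) → Fin n → ℝ := fun x i => if x i then 1 else 0
  have hb : ∀ x y, (hammingDist x y : ℝ) = ∑ i, (b x i + b y i - 2 * (b x i * b y i)) := by
    intro x y
    rw [hammingDist_eq_sum]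
    push_cast
    refine Finset.sum_congr rfl fun i _ => ?_
    simp only [b]
    cases x i <;> cases y i <;> norm_num
  have hli : LinearIndependent ℝ (fun x : S => (b x, (1 : ℝ))) := by
    rw [Fintype.linearIndependent_iff]
    intro g hg
    have h1 : ∑ x, g x = 0 := by simpa [Prod.snd_sum] using congrArg Prod.snd hg
    have h2 : ∀ i, ∑ x, g x * b x i = 0 := by
      intro i
      simpa [Prod.fst_sum] using congrFun (congrArg Prod.fst hg) i
    have h3 : ∑ x, ∑ y, g x * g y * (hammingDist (x : Fin n → Bool) y : ℝ) = 0 := by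
      have h4 : ∀ x y : S, g x * g y * (hammingDist (x : Fin n → Bool) y : ℝ) =
          ∑ i, (g x * b x i * g y + g x * (g y * b y i) -
            2 * (g x * b x i) * (g y * b y i)) := by
        intro x y
        rw [hb, Finset.mul_sum]
        exact Finset.sum_congr rfl fun i _ => by ring
      simp only [h4]
      refine Finset.sum_eq_zero fun x _ => ?_
      rw [Finset.sum_comm]
      refine Finset.sum_eq_zero fun i _ => ?_
      rw [Finset.sum_sub_distrib, Finset.sum_add_distrib, ← Finset.mul_sum, ← Finset.mul_sum,
        ← Finset.mul_sum, h1, h2]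
      ring
    have h5 : ∀ x y : S, g x * g y * (hammingDist (x : Fin n → Bool) y : ℝ) =
        d * g x * g y - if x = y then d * (g x * g x) else 0 := by
      intro x y
      split_ifs with h
      · subst h; simp; ring
      · rw [hS.2 x x.2 y y.2 (fun h' => h (Subtype.ext h'))]; ring
    have h6 : (d : ℝ) * ∑ x, g x * g x = 0 := by
      simp only [h5, Finset.sum_sub_distrib, ← Finset.mul_sum, h1] at h3
      simpa [Finset.mul_sum] using h3
    have h7 : ∑ x, g x * g x = 0 := by simpa [hd] using h6
    intro x
    simpa using (Finset.sum_eq_zero_iff_of_nonneg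
      (fun x _ => mul_self_nonneg (g x))).1 h7 x (Finset.mem_univ x)
  simpa using hli.fintype_card_le_finrank

lemma equilateralDim_le {d : ℕ} (hd : d ≠ 0) (n : ℕ) : equilateralDim d n ≤ n + 1 :=
  csSup_le ⟨1, {fun _ => false}, ⟨by simp, by simp⟩, by simp⟩ <| by
    rintro m ⟨S, hS, rfl⟩
    exact hS.card_le hd

lemma HasEquidistantFamily.le_equilateralDim {d n m : ℕ} (h : HasEquidistantFamily d n m)
    (hd : d ≠ 0) (hm : m ≠ 0) : m ≤ equilateralDim d n := by
  obtain ⟨c, hc⟩ := h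
  have hinj : Function.Injective c := by
    intro i j hij
    by_contra hne
    have := hc i j hne
    rw [hij, hammingDist_self] at this
    exact hd this.symm
  refine le_csSup ⟨n + 1, ?_⟩ ⟨Finset.univ.map ⟨c, hinj⟩, ⟨?_, ?_⟩, by simp⟩
  · rintro _ ⟨S, hS, rfl⟩
    exact hS.card_le hd
  · have : NeZero m := ⟨hm⟩
    simp
  · simp only [Finset.mem_map, Finset.mem_univ, true_and, Function.Embedding.coeFn_mk]
    rintro _ ⟨i, rfl⟩ _ ⟨j, rfl⟩ hne
    exact hc i j fun h => hne (by rw [h])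

lemma isBoundedUnder_log_equilateralDim {α : ℝ} (hα : 0 ≤ α) :
    IsBoundedUnder (· ≤ ·) atTop fun n : ℕ =>
      Real.log (equilateralDim ⌊(n : ℝ) ^ α⌋₊ n) / Real.log n := by
  refine isBoundedUnder_of_eventually_le (a := 2) ?_
  filter_upwards [eventually_ge_atTop 2] with n hn
  have hn' : (2 : ℝ) ≤ n := by exact_mod_cast hn
  have hlog : 0 < Real.log n := Real.log_pos (by linarith)
  have hd : ⌊(n : ℝ) ^ α⌋₊ ≠ 0 :=
    (Nat.floor_pos.2 (Real.one_le_rpow (by linarith) hα)).ne'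
  have he : (equilateralDim ⌊(n : ℝ) ^ α⌋₊ n : ℝ) ≤ (n : ℝ) ^ 2 := by
    have : (equilateralDim ⌊(n : ℝ) ^ α⌋₊ n : ℝ) ≤ n + 1 := by
      exact_mod_cast equilateralDim_le hd n
    nlinarith
  rw [div_le_iff₀ hlog]
  rcases (Nat.cast_nonneg (α := ℝ) (equilateralDim ⌊(n : ℝ) ^ α⌋₊ n)).eq_or_lt with h | h
  · rw [← h, Real.log_zero]; positivity
  · calc _ ≤ Real.log ((n : ℝ) ^ 2) := Real.log_le_log h he
      _ = _ := by rw [Real.log_pow]; norm_num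

lemma le_limsup_log_equilateralDim {α A B C : ℝ} (hα : 0 ≤ α) (hB : 0 < B) (hC : 0 < C)
    (h : ∀ p : ℕ, p.Prime → ∃ n : ℕ, p ≤ n ∧ (n : ℝ) ≤ C * (p : ℝ) ^ B ∧
      (p : ℝ) ^ A ≤ equilateralDim ⌊(n : ℝ) ^ α⌋₊ n) :
    A / B ≤ limsup (fun n : ℕ =>
      Real.log (equilateralDim ⌊(n : ℝ) ^ α⌋₊ n) / Real.log n) atTop := by
  refine le_of_forall_lt_imp_le_of_dense fun c hc => ?_
  refine le_limsup_of_frequently_le ?_ (isBoundedUnder_log_equilateralDim hα)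
  rw [frequently_atTop]
  intro N
  rw [lt_div_iff₀ hB] at hc
  obtain ⟨p, hp, hpp⟩ := Nat.exists_infinite_primes
    (max N ⌈Real.exp (c * Real.log C / (A - c * B))⌉₊)
  obtain ⟨n, hpn, hn, he⟩ := h p hpp
  refine ⟨n, (le_of_max_le_left hp).trans hpn, ?_⟩
  have hp0 : (0 : ℝ) < p := by exact_mod_cast hpp.pos
  have hn1 : (1 : ℝ) < n := by exact_mod_cast hpp.one_lt.trans_le hpn
  have hlog : 0 < Real.log n := Real.log_pos hn1
  rcases le_or_gt c 0 with hc0 | hc0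
  · exact hc0.trans (div_nonneg (Real.log_natCast_nonneg _) hlog.le)
  have hplog : c * Real.log C / (A - c * B) ≤ Real.log p :=
    (Real.le_log_iff_exp_le hp0).2 (Nat.ceil_le.1 (le_of_max_le_right hp))
  rw [div_le_iff₀ (by linarith)] at hplog
  have he' : A * Real.log p ≤ Real.log (equilateralDim ⌊(n : ℝ) ^ α⌋₊ n) := by
    rw [← Real.log_rpow hp0]
    exact Real.log_le_log (by positivity) he
  have hn' : Real.log n ≤ Real.log C + B * Real.log p := by
    rw [← Real.log_rpow hp0, ← Real.log_mul (by positivity) (by positivity)]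
    exact Real.log_le_log (by linarith) hn
  rw [le_div_iff₀ hlog]
  nlinarith [mul_le_mul_of_nonneg_left hn' hc0.le]

lemma floor_rpow_ceil_rpow_inv {α : ℝ} (hα : 0 < α) (hα1 : α ≤ 1) {d : ℕ} (hd : d ≠ 0) :
    ⌊(⌈(d : ℝ) ^ α⁻¹⌉₊ : ℝ) ^ α⌋₊ = d := by
  set x : ℝ := (d : ℝ) ^ α⁻¹
  have hx0 : 0 ≤ x := by positivity
  have hx : x ^ α = d := Real.rpow_inv_rpow (by positivity) hα.ne'
  have hx1 : 1 ≤ x := Real.one_le_rpow (by exact_mod_cast Nat.one_le_iff_ne_zero.2 hd)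
    (by positivity)
  rw [Nat.floor_eq_iff (by positivity)]
  refine ⟨hx ▸ Real.rpow_le_rpow hx0 (Nat.le_ceil x) hα.le, ?_⟩
  calc (⌈x⌉₊ : ℝ) ^ α < (x + 1) ^ α :=
        Real.rpow_lt_rpow (by positivity) (Nat.ceil_lt_add_one hx0) hα
    _ ≤ x ^ α + 1 ^ α := Real.rpow_add_le_add_rpow hx0 zero_le_one hα.le hα1
    _ = d + 1 := by rw [hx, Real.one_rpow]

lemma le_limsup_of_repeat (k : ℕ) {α s : ℝ} (hα : 0 < α) (hα1 : α < 1) (hs : 0 ≤ s)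
    (hsα : (1 - α)⁻¹ ≤ s + 2 ^ k) (hpos : 0 < s + 2 ^ k - 1) :
    2 ^ k / ((s + 2 ^ k - 1) / α) ≤ limsup (fun n : ℕ =>
      Real.log (equilateralDim ⌊(n : ℝ) ^ α⌋₊ n) / Real.log n) atTop := by
  refine le_limsup_log_equilateralDim (C := 2 * 4 ^ α⁻¹) hα.le (by positivity) (by positivity)
    fun p hp => ?_
  have hp1 : (1 : ℝ) ≤ p := by exact_mod_cast hp.one_lt.le
  have hp0 : (0 : ℝ) < p := by linarith
  have hk : 1 ≤ 2 ^ k := Nat.one_le_two_pow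
  obtain ⟨n₀, hn₀, hfam⟩ := exists_hasEquidistantFamily hp k
  set t : ℕ := ⌈(p : ℝ) ^ s⌉₊ with ht_def
  have hps : 1 ≤ (p : ℝ) ^ s := Real.one_le_rpow hp1 hs
  have ht : (p : ℝ) ^ s ≤ t := Nat.le_ceil _
  have ht2 : (t : ℝ) ≤ 2 * (p : ℝ) ^ s := by
    linarith [Nat.ceil_lt_add_one (zero_le_one.trans hps)]
  have ht0 : 0 < t := by exact_mod_cast zero_lt_one.trans_le (hps.trans ht)
  set d := t * (2 * p ^ (2 ^ k - 1)) with hd_def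
  have hd : d ≠ 0 := by have := hp.pos; positivity
  have hd1 : (1 : ℝ) ≤ d := by exact_mod_cast Nat.one_le_iff_ne_zero.2 hd
  set X : ℝ := t * (2 * p ^ 2 ^ k) with hX_def
  have ht1 : (1 : ℝ) ≤ t := by exact_mod_cast ht0
  have hX0 : 0 < X := by positivity
  have hdX : (d : ℝ) * p = X := by
    rw [hd_def, hX_def]
    push_cast
    rw [mul_assoc, mul_assoc, ← pow_succ, Nat.sub_add_cancel hk]
  have hpX : (p : ℝ) ≤ X ^ (1 - α) := by
    have h1 : (p : ℝ) ^ (1 - α)⁻¹ ≤ X := by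
      calc (p : ℝ) ^ (1 - α)⁻¹ ≤ (p : ℝ) ^ (s + 2 ^ k) := Real.rpow_le_rpow_of_exponent_le hp1 hsα
        _ = (p : ℝ) ^ s * (p : ℝ) ^ 2 ^ k := by
          rw [Real.rpow_add hp0, ← Real.rpow_natCast _ (2 ^ k)]; push_cast; rfl
        _ ≤ t * (2 * p ^ 2 ^ k) := by
          gcongr
          have : (0 : ℝ) ≤ (p : ℝ) ^ 2 ^ k := by positivity
          linarith
    calc (p : ℝ) = ((p : ℝ) ^ (1 - α)⁻¹) ^ (1 - α) :=
          (Real.rpow_inv_rpow hp0.le (by linarith)).symm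
      _ ≤ X ^ (1 - α) := Real.rpow_le_rpow (by positivity) h1 (by linarith)
  have hXd : X ^ α ≤ d := by
    have h1 : X ^ α * X ^ (1 - α) = X := by
      rw [← Real.rpow_add hX0]; simp
    have h2 : X ^ α * p ≤ d * p := by
      rw [hdX]
      calc X ^ α * p ≤ X ^ α * X ^ (1 - α) := by gcongr
        _ = X := h1
    exact le_of_mul_le_mul_right h2 hp0
  have hXn : X ≤ (⌈(d : ℝ) ^ α⁻¹⌉₊ : ℝ) :=
    ((Real.le_rpow_inv_iff_of_pos hX0.le (by linarith) hα).2 hXd).trans (Nat.le_ceil _)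
  have hlen : t * n₀ ≤ ⌈(d : ℝ) ^ α⁻¹⌉₊ := by
    have h1 : ((t * n₀ : ℕ) : ℝ) ≤ X := by
      rw [hX_def]
      exact_mod_cast Nat.mul_le_mul_left t hn₀
    exact_mod_cast h1.trans hXn
  refine ⟨⌈(d : ℝ) ^ α⁻¹⌉₊, ?_, ?_, ?_⟩
  · have h1 : (p : ℝ) ≤ X := by nlinarith
    exact_mod_cast h1.trans hXn
  · have h1 : (1 : ℝ) ≤ (d : ℝ) ^ α⁻¹ := Real.one_le_rpow hd1 (by positivity)
    have h2 : (d : ℝ) ≤ 4 * (p : ℝ) ^ (s + 2 ^ k - 1) := by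
      have h3 : (p : ℝ) ^ (s + 2 ^ k - 1) = (p : ℝ) ^ s * (p : ℝ) ^ (2 ^ k - 1) := by
        rw [add_sub_assoc, Real.rpow_add hp0, ← Real.rpow_natCast _ (2 ^ k - 1)]
        push_cast [hk]
        rfl
      rw [h3, hd_def]
      push_cast
      calc (t : ℝ) * (2 * p ^ (2 ^ k - 1)) ≤ (2 * (p : ℝ) ^ s) * (2 * p ^ (2 ^ k - 1)) := by gcongr
        _ = _ := by ring
    calc (⌈(d : ℝ) ^ α⁻¹⌉₊ : ℝ) ≤ 2 * (d : ℝ) ^ α⁻¹ := by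
          linarith [Nat.ceil_lt_add_one (zero_le_one.trans h1)]
      _ ≤ 2 * (4 * (p : ℝ) ^ (s + 2 ^ k - 1)) ^ α⁻¹ := by gcongr
      _ = _ := by
        rw [Real.mul_rpow (by norm_num) (by positivity), ← Real.rpow_mul hp0.le, div_eq_mul_inv,
          mul_assoc]
  · rw [floor_rpow_ceil_rpow_inv hα hα1.le hd]
    have h1 := ((hfam.replicate t).mono_length hlen).le_equilateralDim hd
      (pow_pos hp.pos _).ne'
    calc (p : ℝ) ^ (2 ^ k : ℝ) = ((p ^ 2 ^ k : ℕ) : ℝ) := by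
          rw [show (2 ^ k : ℝ) = ((2 ^ k : ℕ) : ℝ) by push_cast; rfl, Real.rpow_natCast]
          push_cast
          rfl
      _ ≤ _ := by exact_mod_cast h1

theorem limsup_equilateralDim_pow_large_alpha (k : ℕ) (hk : 1 ≤ k) (α : ℝ)
    (h1 : 1 - 2 ^ (-(k : ℤ)) ≤ α) (h2 : α ≤ 1 - 2 ^ (-(k + 1 : ℤ))) :
    max ((1 - α) * 2 ^ k) (α / (1 - 2 ^ (-(k + 1 : ℤ)))) ≤
      limsup (fun n : ℕ =>
        Real.log (equilateralDim ⌊(n : ℝ) ^ α⌋₊ n) / Real.log n) atTop := by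
  have hk2 : (2 : ℝ) ≤ 2 ^ k := by simpa using pow_le_pow_right₀ (one_le_two (α := ℝ)) hk
  have hz : (2 : ℝ) ^ (-(k + 1 : ℤ)) = (2 ^ (k + 1))⁻¹ := by
    rw [zpow_neg]; norm_cast
  rw [zpow_neg, zpow_natCast] at h1
  rw [hz] at h2 ⊢
  have hinv : ((2 : ℝ) ^ k)⁻¹ ≤ 1 / 2 := by
    rw [inv_eq_one_div]; exact one_div_le_one_div_of_le two_pos hk2
  have hinv' : (0 : ℝ) < (2 ^ (k + 1))⁻¹ := by positivity
  have hα : 0 < α := by linarith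
  have hα1 : α < 1 := by linarith
  refine max_le ?_ ?_
  · have hle : (2 : ℝ) ^ k ≤ (1 - α)⁻¹ := by
      rw [le_inv_comm₀ (by positivity) (by linarith)]; linarith
    have hB : (1 - α)⁻¹ - 2 ^ k + 2 ^ k - 1 = α / (1 - α) := by
      have : 1 - α ≠ 0 := by linarith
      field_simp
      ring
    have := le_limsup_of_repeat k (s := (1 - α)⁻¹ - 2 ^ k) hα hα1 (by linarith) (by simp)
      (by rw [hB]; exact div_pos hα (by linarith))
    refine (Eq.le ?_).trans this
    rw [hB]
    field_simp
  · have hlt : (1 : ℝ) < 2 ^ (k + 1) := by rw [pow_succ]; linarith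
    have hsub : (2 : ℝ) ^ (k + 1) - 1 ≠ 0 := by linarith
    have := le_limsup_of_repeat (k + 1) (s := 0) hα hα1 le_rfl
      (by rw [zero_add, inv_le_comm₀ (by linarith) (by positivity)]; linarith) (by linarith)
    refine (Eq.le ?_).trans this
    rw [zero_add]
    field_simp
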